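/- Let K be a simplicial complex, fix an integer m ≥ 1, and let pr_1, pr_2 : K × K → K be the projections of the categorical product onto the first and second factors. Then TC^m(K) = SD_m(pr_1, pr_2). -/

import Mathlib

noncomputable section
open scoped Classical

/-- An abstract simplicial complex on vertex type `V`: a collection of nonempty
finite subsets (simplices) closed under passing to nonempty subsets. -/
structure SComplex (V : Type) where
  faces : Set (Finset V)
  nonempty_of_mem : ∀ σ ∈ faces, σ.Nonempty
  down_closed : ∀ σ ∈ faces, ∀ τ ⊆ σ, τ.Nonempty → τ ∈ faces

namespace SComplex

/-- `f` is a simplicial map from `K` to `L`. -/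
def IsSimplicialMap {V W : Type} (K : SComplex V) (L : SComplex W) (f : V → W) : Prop :=
  ∀ σ ∈ K.faces, σ.image f ∈ L.faces

/-- `f` and `g` are contiguous as maps from `K` to `L`. -/
def Contiguous {V W : Type} (K : SComplex V) (L : SComplex W) (f g : V → W) : Prop :=
  ∀ σ ∈ K.faces, σ.image f ∪ σ.image g ∈ L.faces

/-- `f` and `g` are in the same contiguity class: there is a finite chain of
simplicial maps from `f` to `g` in which consecutive maps are contiguous. -/
def SameClass {V W : Type} (K : SComplex V) (L : SComplex W) (f g : V → W) : Prop :=
  Relation.ReflTransGen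
    (fun a b => K.IsSimplicialMap L a ∧ K.IsSimplicialMap L b ∧ K.Contiguous L a b) f g

/-- `K'` is a subcomplex of `K`. -/
def IsSubcomplex {V : Type} (K' K : SComplex V) : Prop :=
  K'.faces ⊆ K.faces

/-- `Ks` is a covering of `K` by subcomplexes. -/
def Covers {V : Type} (K : SComplex V) {k : ℕ} (Ks : Fin (k + 1) → SComplex V) : Prop :=
  (∀ j, (Ks j).IsSubcomplex K) ∧ ∀ σ ∈ K.faces, ∃ j, σ ∈ (Ks j).faces

/-- `P` has dimension at most `m`. -/
def DimLE {U : Type} (P : SComplex U) (m : ℕ) : Prop :=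
  ∀ σ ∈ P.faces, σ.card ≤ m + 1

/-- The `m`-contiguity distance `SD_m(φ, ψ)`. -/
noncomputable def SDm {V W : Type} (m : ℕ) (K : SComplex V) (L : SComplex W)
    (φ ψ : V → W) : ℕ∞ :=
  sInf {n : ℕ∞ | ∃ k : ℕ, n = (k : ℕ∞) ∧ ∃ Ks : Fin (k + 1) → SComplex V, K.Covers Ks ∧
    ∀ j, ∀ (P : Type) (PC : SComplex P), PC.DimLE m →
      ∀ η : P → V, PC.IsSimplicialMap (Ks j) η → PC.SameClass L (φ ∘ η) (ψ ∘ η)}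

/-- The contiguity distance `SD(φ, ψ)`. -/
noncomputable def SD {V W : Type} (K : SComplex V) (L : SComplex W) (φ ψ : V → W) : ℕ∞ :=
  sInf {n : ℕ∞ | ∃ k : ℕ, n = (k : ℕ∞) ∧ ∃ Ks : Fin (k + 1) → SComplex V, K.Covers Ks ∧
    ∀ j, (Ks j).SameClass L φ ψ}

/-- The `m`-simplicial Lusternik–Schnirelmann category `scat_m(K)`. -/
noncomputable def scatm {V : Type} (m : ℕ) (K : SComplex V) : ℕ∞ :=
  sInf {n : ℕ∞ | ∃ k : ℕ, n = (k : ℕ∞) ∧ ∃ Ks : Fin (k + 1) → SComplex V, K.Covers Ks ∧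
    ∀ j, ∀ (P : Type) (PC : SComplex P), PC.DimLE m →
      ∀ η : P → V, PC.IsSimplicialMap (Ks j) η →
        ∃ v0 : V, PC.SameClass K η (fun _ => v0)}

/-- The simplicial Lusternik–Schnirelmann category `scat(K)`. -/
noncomputable def scat {V : Type} (K : SComplex V) : ℕ∞ :=
  sInf {n : ℕ∞ | ∃ k : ℕ, n = (k : ℕ∞) ∧ ∃ Ks : Fin (k + 1) → SComplex V, K.Covers Ks ∧
    ∀ j, ∃ v0 : V, (Ks j).SameClass K id (fun _ => v0)}

/-- The categorical product of two simplicial complexes. -/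
def prod {V W : Type} (K : SComplex V) (L : SComplex W) : SComplex (V × W) where
  faces := {σ | σ.Nonempty ∧ σ.image Prod.fst ∈ K.faces ∧ σ.image Prod.snd ∈ L.faces}
  nonempty_of_mem := fun _ h => h.1
  down_closed := by
    rintro σ ⟨-, h1, h2⟩ τ hτσ hτ
    exact ⟨hτ, K.down_closed _ h1 _ (Finset.image_subset_image hτσ) (hτ.image _),
      L.down_closed _ h2 _ (Finset.image_subset_image hτσ) (hτ.image _)⟩

/-- The barycentric subdivision: vertices are the simplices of `K`, simplices are
the chains of simplices of `K` (totally ordered by inclusion). -/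
def sd {V : Type} (K : SComplex V) : SComplex (Finset V) where
  faces := {S | S.Nonempty ∧ (∀ σ ∈ S, σ ∈ K.faces) ∧ ∀ σ ∈ S, ∀ τ ∈ S, σ ⊆ τ ∨ τ ⊆ σ}
  nonempty_of_mem := fun _ h => h.1
  down_closed := by
    rintro S ⟨-, h1, h2⟩ T hTS hT
    exact ⟨hT, fun σ hσ => h1 σ (hTS hσ), fun σ hσ τ hτ => h2 σ (hTS hσ) τ (hTS hτ)⟩

/-- The map induced on barycentric subdivisions: `sd(f)(σ) = f(σ)`. -/
def sdMap {V W : Type} (f : V → W) : Finset V → Finset W :=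
  fun σ => σ.image f

/-- The `m`-dimensional simplicial Švarc genus `secat_m(φ)`. -/
noncomputable def secatm {V W : Type} (m : ℕ) (K : SComplex V) (L : SComplex W)
    (φ : V → W) : ℕ∞ :=
  sInf {n : ℕ∞ | ∃ k : ℕ, n = (k : ℕ∞) ∧ ∃ Ls : Fin (k + 1) → SComplex W, L.Covers Ls ∧
    ∀ j, ∀ (P : Type) (PC : SComplex P), PC.DimLE m →
      ∀ η : P → W, PC.IsSimplicialMap (Ls j) η →
        ∃ s : P → V, PC.IsSimplicialMap K s ∧ φ ∘ s = η}

/-- The `m`-dimensional homotopy simplicial Švarc genus `hsecat_m(φ)`. -/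
noncomputable def hsecatm {V W : Type} (m : ℕ) (K : SComplex V) (L : SComplex W)
    (φ : V → W) : ℕ∞ :=
  sInf {n : ℕ∞ | ∃ k : ℕ, n = (k : ℕ∞) ∧ ∃ Ls : Fin (k + 1) → SComplex W, L.Covers Ls ∧
    ∀ j, ∀ (P : Type) (PC : SComplex P), PC.DimLE m →
      ∀ η : P → W, PC.IsSimplicialMap (Ls j) η →
        ∃ s : P → V, PC.IsSimplicialMap K s ∧ PC.SameClass L (φ ∘ s) η}

/-- The `m`-simplicial LS category `scat_m(φ)` of a simplicial map `φ : K → L`. -/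
noncomputable def scatmMap {V W : Type} (m : ℕ) (K : SComplex V) (L : SComplex W)
    (φ : V → W) : ℕ∞ :=
  sInf {n : ℕ∞ | ∃ k : ℕ, n = (k : ℕ∞) ∧ ∃ Ks : Fin (k + 1) → SComplex V, K.Covers Ks ∧
    ∀ j, ∀ (P : Type) (PC : SComplex P), PC.DimLE m →
      ∀ η : P → V, PC.IsSimplicialMap (Ks j) η →
        ∃ w0 : W, PC.SameClass L (φ ∘ η) (fun _ => w0)}

/-- `p : E → B` is a simplicial fibration. -/
def IsFibration {Ve Vb : Type} (E : SComplex Ve) (B : SComplex Vb) (p : Ve → Vb) : Prop :=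
  ∀ (X : Type) (KC : SComplex X) (ℓ : ℕ) (φs : Fin (ℓ + 1) → X → Vb),
    (∀ i, KC.IsSimplicialMap B (φs i)) →
    (∀ i : Fin ℓ, KC.Contiguous B (φs i.castSucc) (φs i.succ)) →
    ∀ φt : X → Ve, KC.IsSimplicialMap E φt → p ∘ φt = φs 0 →
      ∃ φts : Fin (ℓ + 1) → X → Ve, φts 0 = φt ∧
        (∀ i, KC.IsSimplicialMap E (φts i)) ∧
        (∀ i : Fin ℓ, KC.Contiguous E (φts i.castSucc) (φts i.succ)) ∧
        ∀ i, p ∘ φts i = φs i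

/-- `β : K → M` is a strong equivalence. -/
def IsStrongEquivalence {V U : Type} (K : SComplex V) (M : SComplex U) (β : V → U) : Prop :=
  K.IsSimplicialMap M β ∧ ∃ δ : U → V, M.IsSimplicialMap K δ ∧
    K.SameClass K (δ ∘ β) id ∧ M.SameClass M (β ∘ δ) id

/-- The diagonal map `Δ : V → V × V`. -/
def diag (V : Type) : V → V × V := fun v => (v, v)

/-- The `m`-discrete topological complexity `TC^m(K)`. -/
noncomputable def TCm {V : Type} (m : ℕ) (K : SComplex V) : ℕ∞ :=
  sInf {n : ℕ∞ | ∃ k : ℕ, n = (k : ℕ∞) ∧ ∃ Ωs : Fin (k + 1) → SComplex (V × V),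
    (K.prod K).Covers Ωs ∧
    ∀ j, ∃ σj : V × V → V, (Ωs j).IsSimplicialMap K σj ∧
      ∀ (P : Type) (PC : SComplex P), PC.DimLE m →
        ∀ η : P → V × V, PC.IsSimplicialMap (Ωs j) η →
          PC.SameClass (K.prod K) (diag V ∘ σj ∘ η) η}

/-- The discrete topological complexity `TC(K)`. -/
noncomputable def TC {V : Type} (K : SComplex V) : ℕ∞ :=
  sInf {n : ℕ∞ | ∃ k : ℕ, n = (k : ℕ∞) ∧ ∃ Ωs : Fin (k + 1) → SComplex (V × V),
    (K.prod K).Covers Ωs ∧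
    ∀ j, ∃ σj : V × V → V, (Ωs j).IsSimplicialMap K σj ∧
      (Ωs j).SameClass (K.prod K) (diag V ∘ σj) id}

end SComplex

namespace SComplex

variable {U V W : Type}

lemma image_image_comp (f : U → V) (g : V → W) (σ : Finset U) :
    (σ.image f).image g = σ.image (g ∘ f) :=
  Finset.image_image

lemma image_union_image_image (f g : U → V) (h : V → W) (σ : Finset U) :
    (σ.image f ∪ σ.image g).image h = σ.image (h ∘ f) ∪ σ.image (h ∘ g) := by
  rw [Finset.image_union, Finset.image_image, Finset.image_image]

lemma mem_prod_faces {K : SComplex V} {L : SComplex W} {σ : Finset (V × W)} :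
    σ ∈ (K.prod L).faces ↔ σ.image Prod.fst ∈ K.faces ∧ σ.image Prod.snd ∈ L.faces :=
  ⟨fun h => h.2, fun h => ⟨(K.nonempty_of_mem _ h.1).of_image, h⟩⟩

lemma isSimplicialMap_of_isSubcomplex {K K' : SComplex V} {L : SComplex W} {f : V → W}
    (hf : K.IsSimplicialMap L f) (h : K'.IsSubcomplex K) : K'.IsSimplicialMap L f :=
  fun σ hσ => hf σ (h hσ)

lemma IsSimplicialMap.comp {P : SComplex U} {K : SComplex V} {L : SComplex W} {g : V → W}
    {f : U → V} (hg : K.IsSimplicialMap L g) (hf : P.IsSimplicialMap K f) :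
    P.IsSimplicialMap L (g ∘ f) := by
  intro σ hσ
  rw [← Finset.image_image]
  exact hg _ (hf σ hσ)

lemma isSimplicialMap_fst (K : SComplex V) (L : SComplex W) :
    (K.prod L).IsSimplicialMap K Prod.fst :=
  fun _ h => h.2.1

lemma isSimplicialMap_snd (K : SComplex V) (L : SComplex W) :
    (K.prod L).IsSimplicialMap L Prod.snd :=
  fun _ h => h.2.2

lemma IsSimplicialMap.prodMk {P : SComplex U} {K : SComplex V} {L : SComplex W}
    {f : U → V} {g : U → W} (hf : P.IsSimplicialMap K f) (hg : P.IsSimplicialMap L g) :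
    P.IsSimplicialMap (K.prod L) (fun x => (f x, g x)) := by
  intro σ hσ
  refine mem_prod_faces.2 ⟨?_, ?_⟩
  · rw [image_image_comp]
    exact hf σ hσ
  · rw [image_image_comp]
    exact hg σ hσ

lemma SameClass.symm {K : SComplex V} {L : SComplex W} {f g : V → W}
    (h : K.SameClass L f g) : K.SameClass L g f := by
  refine Relation.ReflTransGen.mono ?_ _ _ (Relation.ReflTransGen.swap _ _ h)
  rintro a b ⟨hb, ha, hab⟩
  refine ⟨ha, hb, fun σ hσ => ?_⟩
  rw [Finset.union_comm]
  exact hab σ hσ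

lemma SameClass.comp_left {P : SComplex U} {K : SComplex V} {L : SComplex W} {h : V → W}
    (hh : K.IsSimplicialMap L h) {f g : U → V} (hfg : P.SameClass K f g) :
    P.SameClass L (h ∘ f) (h ∘ g) := by
  refine Relation.ReflTransGen.lift (fun a => h ∘ a) ?_ _ _ hfg
  rintro a b ⟨ha, hb, hab⟩
  refine ⟨hh.comp ha, hh.comp hb, fun σ hσ => ?_⟩
  rw [← image_union_image_image]
  exact hh _ (hab σ hσ)

lemma SameClass.prodMk_left {P : SComplex U} {K : SComplex V} {L : SComplex W} {a : U → V}
    (ha : P.IsSimplicialMap K a) {f g : U → W} (hfg : P.SameClass L f g) :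
    P.SameClass (K.prod L) (fun x => (a x, f x)) (fun x => (a x, g x)) := by
  refine Relation.ReflTransGen.lift (fun (b : U → W) (x : U) => (a x, b x)) ?_ _ _ hfg
  rintro b c ⟨hb, hc, hbc⟩
  refine ⟨ha.prodMk hb, ha.prodMk hc, fun σ hσ => mem_prod_faces.2 ⟨?_, ?_⟩⟩
  · rw [image_union_image_image]
    exact (Finset.union_self (σ.image a)).symm ▸ ha σ hσ
  · rw [image_union_image_image]
    exact hbc σ hσ

end SComplex

open SComplex

/-- `TC^m(K) = SD_m(pr₁, pr₂)`. -/
theorem TCm_eq_SDm_proj {V : Type} (K : SComplex V) (m : ℕ) (hm : 1 ≤ m) :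
    TCm m K = SDm m (K.prod K) K Prod.fst Prod.snd := by
  unfold TCm SDm
  congr 1
  ext n
  refine exists_congr fun k => and_congr_right fun _ => exists_congr fun Ωs =>
    and_congr_right fun hΩ => forall_congr' fun j => ⟨?_, fun h => ?_⟩
  · rintro ⟨s, -, h⟩ P PC hP η hη
    have hs := h P PC hP η hη
    exact (hs.comp_left (isSimplicialMap_fst K K)).symm.trans
      (hs.comp_left (isSimplicialMap_snd K K))
  · have hfst := isSimplicialMap_of_isSubcomplex (isSimplicialMap_fst K K) (hΩ.1 j)
    exact ⟨Prod.fst, hfst, fun P PC hP η hη =>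
      (h P PC hP η hη).prodMk_left (hfst.comp hη)⟩
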